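/- arXiv:math/0312306 — 5 statements merged into one kernel-verified Lean document; each statement's English description precedes it below -/
import Mathlib

section
/- Let φ be a virtual endomorphism of a group G, let T = {r_x}_{x∈X} be a right coset transversal for Dom φ in G (indexed by a set X of cardinality the index of Dom φ), and let C = {h_x}_{x∈X} be a family of elements of G. Then there exists a unique action of G on the rooted tree X^* by tree automorphisms satisfying the recursion (xw)^g = y · w^{h_x⁻¹ φ(r_x g r_y⁻¹) h_y} for all x ∈ X, w ∈ X^*, g ∈ G, where y ∈ X is the unique letter with r_x g r_y⁻¹ ∈ Dom φ. -/
/-- The right action on words over `X` of a Mealy automaton whose states are the elements of `G`: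
in state `g`, the letter `x` is replaced by `σ x g` and the state becomes `τ x g`. -/
def wordAction {G X : Type*} (σ : X → G → X) (τ : X → G → G) : List X → G → List X
  | [], _ => []
  | x :: w, g => σ x g :: wordAction σ τ w (τ x g)

section wordAction

variable {G X : Type*} {σ : X → G → X} {τ : X → G → G}

theorem length_wordAction (w : List X) (g : G) : (wordAction σ τ w g).length = w.length := by
  induction w generalizing g with
  | nil => rfl
  | cons x w ih => simp [wordAction, ih]

theorem wordAction_one [Group G] (hσ : ∀ x, σ x 1 = x) (hτ : ∀ x, τ x 1 = 1) (w : List X) :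
    wordAction σ τ w 1 = w := by
  induction w with
  | nil => rfl
  | cons x w ih => simp [wordAction, hσ, hτ, ih]

theorem wordAction_mul [Group G] (hσ : ∀ x a b, σ x (a * b) = σ (σ x a) b)
    (hτ : ∀ x a b, τ x (a * b) = τ x a * τ (σ x a) b) (w : List X) (a b : G) :
    wordAction σ τ w (a * b) = wordAction σ τ (wordAction σ τ w a) b := by
  induction w generalizing a b with
  | nil => rfl
  | cons x w ih => simp [wordAction, hσ x a b, hτ x a b, ih]

theorem wordAction_unique {A : List X → G → List X} (hnil : ∀ g, A [] g = [])
    (hcons : ∀ g x w, A (x :: w) g = σ x g :: A w (τ x g)) : A = wordAction σ τ := by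
  funext w
  induction w with
  | nil => exact funext hnil
  | cons x w ih => funext g; rw [hcons, ih, wordAction]

end wordAction

/-- A right action of a group is by bijections. -/
theorem bijective_of_right_action {G S : Type*} [Group G] {A : S → G → S}
    (hone : ∀ w, A w 1 = w) (hmul : ∀ w a b, A w (a * b) = A (A w a) b) (g : G) :
    Function.Bijective fun w => A w g :=
  Function.bijective_iff_has_inverse.mpr ⟨fun w => A w g⁻¹,
    fun w => by simp only [← hmul, mul_inv_cancel, hone],
    fun w => by simp only [← hmul, inv_mul_cancel, hone]⟩


/-- Given a virtual endomorphism `φ : Dom φ → G` of a group `G` (with `Dom φ = D`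
of finite index), a right coset transversal `{r_x}_{x ∈ X}` for `D` and a family
`{h_x}_{x ∈ X}` of elements of `G`, there is a unique right action of `G` on the
rooted tree `X^*` (words over `X`, first letter written first) by tree
automorphisms satisfying the recursion
`(xw)^g = y ⬝ w^{h_x⁻¹ φ(r_x g r_y⁻¹) h_y}`, where `y` is the unique letter with
`r_x g r_y⁻¹ ∈ D`.  Here `A w g` denotes `w^g`. -/
theorem statement3 {G X : Type*} [Group G] (D : Subgroup G) (hD : D.FiniteIndex)
    (φ : D →* G) (r : X → G) (h : X → G)
    (htrans : ∀ g : G, ∃! x : X, g * (r x)⁻¹ ∈ D) :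
    ∃! A : List X → G → List X,
      (∀ w : List X, A w 1 = w) ∧
      (∀ (w : List X) (g₁ g₂ : G), A w (g₁ * g₂) = A (A w g₁) g₂) ∧
      (∀ g : G, Function.Bijective fun w => A w g) ∧
      (∀ (g : G) (w : List X), (A w g).length = w.length) ∧
      (∀ g : G, A [] g = []) ∧
      (∀ (g : G) (x y : X) (hy : r x * g * (r y)⁻¹ ∈ D) (w : List X),
        A (x :: w) g = y :: A w ((h x)⁻¹ * (φ ⟨r x * g * (r y)⁻¹, hy⟩ : G) * h y)) := by
  choose σ' hσ' hσ'_unique using htrans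
  let σ : X → G → X := fun x g => σ' (r x * g)
  have hσ : ∀ x g, r x * g * (r (σ x g))⁻¹ ∈ D := fun x g => hσ' (r x * g)
  have hσ_unique : ∀ x g y, r x * g * (r y)⁻¹ ∈ D → σ x g = y :=
    fun x g y hy => (hσ'_unique (r x * g) y hy).symm
  let τ : X → G → G := fun x g => (h x)⁻¹ * φ ⟨r x * g * (r (σ x g))⁻¹, hσ x g⟩ * h (σ x g)
  have hτ : ∀ x g y (hy : r x * g * (r y)⁻¹ ∈ D),
      τ x g = (h x)⁻¹ * φ ⟨r x * g * (r y)⁻¹, hy⟩ * h y := by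
    intro x g y hy
    obtain rfl := hσ_unique x g y hy
    rfl
  have mem_one : ∀ x, r x * 1 * (r x)⁻¹ ∈ D := fun x => by simp
  have mul_eq : ∀ x a b, r x * (a * b) * (r (σ (σ x a) b))⁻¹ =
      r x * a * (r (σ x a))⁻¹ * (r (σ x a) * b * (r (σ (σ x a) b))⁻¹) := fun x a b => by group
  have mem_mul : ∀ x a b, r x * (a * b) * (r (σ (σ x a) b))⁻¹ ∈ D := fun x a b => by
    rw [mul_eq]
    exact D.mul_mem (hσ x a) (hσ _ b)
  have σ_one : ∀ x, σ x 1 = x := fun x => hσ_unique x 1 x (mem_one x)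
  have σ_mul : ∀ x a b, σ x (a * b) = σ (σ x a) b :=
    fun x a b => hσ_unique x (a * b) _ (mem_mul x a b)
  have τ_one : ∀ x, τ x 1 = 1 := by
    intro x
    have key : (⟨r x * 1 * (r x)⁻¹, mem_one x⟩ : D) = 1 := Subtype.ext (by simp)
    rw [hτ x 1 x (mem_one x), key]
    simp
  have τ_mul : ∀ x a b, τ x (a * b) = τ x a * τ (σ x a) b := by
    intro x a b
    have key : (⟨_, mem_mul x a b⟩ : D) = ⟨_, hσ x a⟩ * ⟨_, hσ (σ x a) b⟩ :=
      Subtype.ext (mul_eq x a b)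
    rw [hτ x (a * b) _ (mem_mul x a b), key, map_mul]
    simp only [τ]
    group
  have one := wordAction_one σ_one τ_one
  have mul := wordAction_mul σ_mul τ_mul
  refine ⟨wordAction σ τ, ⟨one, mul, bijective_of_right_action one mul,
    fun g w => length_wordAction w g, fun _ => rfl, fun g x y hy w => ?_⟩, ?_⟩
  · rw [wordAction, hσ_unique x g y hy, hτ x g y hy]
  · rintro A ⟨-, -, -, -, hnil, hcons⟩
    exact wordAction_unique hnil fun g x w => hcons g x (σ x g) (hσ x g) w
end

section
/- Let G act faithfully and self-similarly on X^*, with the action transitive on the set X of one-letter words. Fix x₀ ∈ X, let φ = φ_{x₀} be the associated virtual endomorphism (with domain the stabilizer of x₀ and φ(g) = g|_{x₀}), choose for each x ∈ X an element r_x ∈ G with x₀^{r_x} = x, and set h_x = r_x|_{x₀}. Then the family {r_x}_{x∈X} is a right coset transversal for Dom φ, and for all g ∈ G, x ∈ X, w ∈ X^* one has (xw)^g = y · w^{h_x⁻¹ φ(r_x g r_y⁻¹) h_y}, where y = x^g (and r_x g r_y⁻¹ ∈ Dom φ). -/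
theorem cons_eq_of_singleton_eq {G X : Type*} {A : List X → G → List X}
    (hnil : ∀ g : G, A [] g = []) {res : G → X → G}
    (hss : ∀ (g : G) (x : X), ∃ y : X, ∀ w : List X, A (x :: w) g = y :: A w (res g x))
    {g : G} {x y : X} (h : A [x] g = [y]) (w : List X) :
    A (x :: w) g = y :: A w (res g x) := by
  obtain ⟨z, hz⟩ := hss g x
  have hzy : z = y := by simpa [hz, hnil] using h
  rw [hz, hzy]


/-- Let `G` act faithfully and self-similarly (on the right, `A w g = w^g`) on the
rooted tree `X^*`, transitively on one-letter words, with restriction map `res`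
(`(xw)^g = x^g ⬝ w^{g|_x}`).  Fix `x₀ ∈ X`, let `φ = φ_{x₀}` be the associated
virtual endomorphism (domain the stabilizer of `x₀`, `φ(g) = g|_{x₀}`), choose
`r_x` with `x₀^{r_x} = x` and set `h_x = r_x|_{x₀}`.  Then `{r_x}` is a right
coset transversal for `Dom φ`, and
`(xw)^g = y ⬝ w^{h_x⁻¹ φ(r_x g r_y⁻¹) h_y}` where `y = x^g` and
`r_x g r_y⁻¹ ∈ Dom φ`. -/
theorem statement4 {G X : Type*} [Group G]
    (A : List X → G → List X)
    (hone : ∀ w : List X, A w 1 = w)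
    (hmul : ∀ (w : List X) (g₁ g₂ : G), A w (g₁ * g₂) = A (A w g₁) g₂)
    (hnil : ∀ g : G, A [] g = [])
    (hfaithful : ∀ g : G, (∀ w : List X, A w g = w) → g = 1)
    (res : G → X → G)
    (hss : ∀ (g : G) (x : X), ∃ y : X, ∀ w : List X, A (x :: w) g = y :: A w (res g x))
    (htrans : ∀ x y : X, ∃ g : G, A [x] g = [y])
    (x₀ : X) (r : X → G) (hr : ∀ x : X, A [x₀] (r x) = [x]) :
    (∀ g : G, ∃! x : X, A [x₀] (g * (r x)⁻¹) = [x₀]) ∧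
    (∀ (g : G) (x y : X), A [x] g = [y] →
      A [x₀] (r x * g * (r y)⁻¹) = [x₀] ∧
      ∀ w : List X, A (x :: w) g =
        y :: A w ((res (r x) x₀)⁻¹ * res (r x * g * (r y)⁻¹) x₀ * res (r y) x₀)) := by
  have hinv : ∀ {u v : List X} {g : G}, A u g = v → A v g⁻¹ = u := by
    rintro u _ g rfl
    rw [← hmul, mul_inv_cancel, hone]
  refine ⟨fun g => ?_, fun g x y hxy => ?_⟩
  · obtain ⟨x, hx⟩ := hss g x₀
    have hx' : A [x₀] g = [x] := by rw [hx, hnil]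
    refine ⟨x, ?_, fun z hz => ?_⟩
    · beta_reduce
      rw [hmul, hx', hinv (hr x)]
    · have h : A [x₀] (g * (r z)⁻¹ * r z) = [z] := by rw [hmul, hz, hr]
      rw [inv_mul_cancel_right, hx'] at h
      exact (List.singleton_inj.mp h).symm
  · have hk : A [x₀] (r x * g * (r y)⁻¹) = [x₀] := by
      rw [hmul, hmul, hr, hxy, hinv (hr y)]
    refine ⟨hk, fun w => ?_⟩
    have hw : A (x₀ :: A w (res (r x) x₀)⁻¹) (r x) = x :: w := by
      rw [cons_eq_of_singleton_eq hnil hss (hr x), ← hmul, inv_mul_cancel, hone]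
    rw [← hw, ← hmul, ← inv_mul_cancel_right (r x * g) (r y), hmul,
      cons_eq_of_singleton_eq hnil hss hk, cons_eq_of_singleton_eq hnil hss (hr y),
      ← hmul, ← hmul, inv_mul_cancel_right, mul_assoc (res (r x) x₀)⁻¹]
end

section
/- Let G act faithfully and self-similarly on X^* (X finite), and suppose the action is contracting with nucleus N. Then two left-infinite sequences …x₂x₁ and …y₂y₁ over X are asymptotically equivalent with respect to the action if and only if there exists a sequence (a_k)_{k≥0} of elements of N such that, for every k ≥ 1: x_k^{a_k} = y_k and a_k|_{x_k} = a_{k−1} (equivalently, the pair of sequences is read along a left-infinite directed path in the Moore diagram of the nucleus). -/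
/-- Iterated restriction `g|_v` along a word `v` (first letter first):
`g|_{xw} = (g|_x)|_w`. -/
def resWord {G X : Type*} (res : G → X → G) : G → List X → G
  | g, [] => g
  | g, x :: w => resWord res (res g x) w

/-- The word `x_k x_{k-1} … x_1` (leftmost letter first) associated to a
left-infinite sequence `… x_2 x_1`, where the sequence is encoded by
`x : ℕ → X` with `x (i - 1) = x_i`. -/
def wordOf {X : Type*} (x : ℕ → X) : ℕ → List X
  | 0 => []
  | k + 1 => x k :: wordOf x k

theorem length_wordOf {X : Type*} (x : ℕ → X) (k : ℕ) : (wordOf x k).length = k := by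
  induction k with
  | zero => rfl
  | succ k ih => simp [wordOf, ih]

/-- Restricting along a word extended on the right by one letter. -/
theorem resWord_wordOf_succ {G X : Type*} (res : G → X → G) (x : ℕ → X) (j i : ℕ) (g : G) :
    resWord res g (wordOf (fun t => x (j + t)) (i + 1)) =
      res (resWord res g (wordOf (fun t => x (j + 1 + t)) i)) (x j) := by
  induction i generalizing g with
  | zero => rfl
  | succ i ih =>
    have hidx : j + (i + 1) = j + 1 + i := by omega
    calc resWord res g (wordOf (fun t => x (j + t)) (i + 1 + 1))
        = resWord res (res g (x (j + (i + 1)))) (wordOf (fun t => x (j + t)) (i + 1)) := rfl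
      _ = res (resWord res (res g (x (j + 1 + i))) (wordOf (fun t => x (j + 1 + t)) i)) (x j) := by
        rw [ih, hidx]

/-- If `g` maps one word to another, then its restriction along a prefix maps the
corresponding suffixes to each other. -/
theorem act_suffix_of_act {G X : Type*} (A : List X → G → List X) (res : G → X → G)
    (hss : ∀ (g : G) (x : X), ∃ y : X, ∀ w : List X, A (x :: w) g = y :: A w (res g x))
    (x y : ℕ → X) (j i : ℕ) (g : G) (h : A (wordOf x (j + i)) g = wordOf y (j + i)) :
    A (wordOf x j) (resWord res g (wordOf (fun t => x (j + t)) i)) = wordOf y j := by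
  induction i generalizing g with
  | zero => exact h
  | succ i ih =>
    obtain ⟨z, hz⟩ := hss g (x (j + i))
    have h' : A (x (j + i) :: wordOf x (j + i)) g = y (j + i) :: wordOf y (j + i) := h
    rw [hz] at h'
    exact ih _ (List.cons.inj h').2

/-- A compactness principle: sequences whose terms eventually lie in a finite set have a
limit point for the topology of pointwise stabilization. -/
theorem exists_pointwise_limit_of_eventually_mem {G : Type*} (N : Finset G) (b : ℕ → ℕ → G)
    (hb : ∀ j, ∀ᶠ m in Filter.atTop, b m j ∈ N) :
    ∃ a : ℕ → G, (∀ j, a j ∈ N) ∧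
      ∀ j, ∀ᶠ m in (Filter.hyperfilter ℕ : Filter ℕ), b m j = a j := by
  have key : ∀ j, ∃ c ∈ N, ∀ᶠ m in (Filter.hyperfilter ℕ : Filter ℕ), b m j = c := by
    intro j
    have hmem : (⋃ c ∈ (N : Set G), {m | b m j = c}) ∈ Filter.hyperfilter ℕ := by
      filter_upwards [Nat.hyperfilter_le_atTop (hb j)] with m hm
      simpa using hm
    exact (Ultrafilter.finite_biUnion_mem_iff N.finite_toSet).1 hmem
  choose a ha hlim using key
  exact ⟨a, ha, hlim⟩

/-- For a faithful self-similar contracting action of `G` on `X^*` (X finite)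
with nucleus `N`, two left-infinite sequences `…x₂x₁`, `…y₂y₁` are
asymptotically equivalent iff there is a sequence `(a_k)_{k ≥ 0}` of elements of
the nucleus with `x_k^{a_k} = y_k` and `a_k|_{x_k} = a_{k-1}` for all `k ≥ 1`,
i.e. the pair of sequences is read along a left-infinite path in the Moore
diagram of the nucleus.  Here `A w g` denotes `w^g`. -/
theorem statement7 {G X : Type*} [Group G] [Finite X]
    (A : List X → G → List X)
    (hone : ∀ w : List X, A w 1 = w)
    (hmul : ∀ (w : List X) (g₁ g₂ : G), A w (g₁ * g₂) = A (A w g₁) g₂)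
    (hnil : ∀ g : G, A [] g = [])
    (hfaithful : ∀ g : G, (∀ w : List X, A w g = w) → g = 1)
    (res : G → X → G)
    (hss : ∀ (g : G) (x : X), ∃ y : X, ∀ w : List X, A (x :: w) g = y :: A w (res g x))
    (N : Finset G)
    (hNclosed : ∀ g ∈ N, ∀ x : X, res g x ∈ N)
    (hNcontract : ∀ g : G, ∃ n : ℕ, ∀ v : List X, n < v.length → resWord res g v ∈ N)
    (hNmin : ∀ M : Finset G, (∀ g ∈ M, ∀ x : X, res g x ∈ M) →
      (∀ g : G, ∃ n : ℕ, ∀ v : List X, n < v.length → resWord res g v ∈ M) → N ⊆ M) :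
    ∀ x y : ℕ → X,
      (∃ g : ℕ → G, (Set.range g).Finite ∧
          ∀ k : ℕ, A (wordOf x k) (g k) = wordOf y k) ↔
      (∃ a : ℕ → G, (∀ k : ℕ, a k ∈ N) ∧
          ∀ k : ℕ, A [x k] (a (k + 1)) = [y k] ∧ res (a (k + 1)) (x k) = a k) := by
  intro x y
  constructor
  · rintro ⟨g, hfin, hg⟩
    obtain ⟨n, hn⟩ : ∃ n : ℕ, ∀ k, ∀ v : List X, n < v.length → resWord res (g k) v ∈ N := by
      choose f hf using hNcontract
      obtain ⟨n, hn⟩ := (hfin.image f).bddAbove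
      exact ⟨n, fun k v hv => hf _ v
        ((hn (Set.mem_image_of_mem f (Set.mem_range_self k))).trans_lt hv)⟩
    let b : ℕ → ℕ → G := fun m j => resWord res (g m) (wordOf (fun t => x (j + t)) (m - j))
    have hb : ∀ j, ∀ᶠ m in Filter.atTop, b m j ∈ N := by
      intro j
      filter_upwards [Filter.eventually_gt_atTop (n + j)] with m hm
      exact hn m _ (by rw [length_wordOf]; omega)
    obtain ⟨a, haN, ha⟩ := exists_pointwise_limit_of_eventually_mem N b hb
    refine ⟨a, haN, fun k => ?_⟩
    have hlarge := Nat.hyperfilter_le_atTop (Filter.eventually_gt_atTop k)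
    obtain ⟨m, hk, hk1, hm⟩ := ((ha k).and ((ha (k + 1)).and hlarge)).exists
    obtain ⟨i, rfl⟩ : ∃ i, m = k + 1 + i := Nat.exists_eq_add_of_le hm
    rw [← hk, ← hk1]
    simp only [b, Nat.add_sub_cancel_left, show k + 1 + i - k = i + 1 by omega]
    refine ⟨?_, (resWord_wordOf_succ res x k i _).symm⟩
    have hact := act_suffix_of_act A res hss x y (k + 1) i _ (hg (k + 1 + i))
    obtain ⟨z, hz⟩ := hss (resWord res (g (k + 1 + i)) (wordOf (fun t => x (k + 1 + t)) i)) (x k)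
    rw [wordOf, hz, wordOf] at hact
    rw [hz, hnil, (List.cons.inj hact).1]
  · rintro ⟨a, haN, ha⟩
    refine ⟨a, N.finite_toSet.subset (Set.range_subset_iff.2 haN), fun k => ?_⟩
    induction k with
    | zero => exact hnil _
    | succ k ih =>
      obtain ⟨hxy, hres⟩ := ha k
      obtain ⟨z, hz⟩ := hss (a (k + 1)) (x k)
      rw [hz, hnil] at hxy
      rw [wordOf, hz, hres, ih, (List.cons.inj hxy).1, wordOf]
end

section
/- Let a and b be the automorphisms of the binary rooted tree {0,1}^* defined recursively by a(0w) = 1w, a(1w) = 0w, b(0w) = 0·b(w), b(1w) = 1·a(w). Then a² = 1, b² = 1, the element ab has infinite order, and the group ⟨a, b⟩ generated by a and b is isomorphic to the infinite dihedral group D_∞. (This group is the iterated monodromy group of the polynomial z² − 2.) -/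
/-- `a(0w) = 1w`, `a(1w) = 0w` (`false = 0`, `true = 1`). -/
def aFun : List Bool → List Bool
  | [] => []
  | x :: w => (!x) :: w

/-- `b(0w) = 0·b(w)`, `b(1w) = 1·a(w)`. -/
def bFun : List Bool → List Bool
  | [] => []
  | false :: w => false :: bFun w
  | true :: w => true :: aFun w

lemma aFun_aFun : ∀ w : List Bool, aFun (aFun w) = w := by
  intro w
  cases w with
  | nil => rfl
  | cons x t => cases x <;> rfl

lemma bFun_bFun : ∀ w : List Bool, bFun (bFun w) = w := by
  intro w
  induction w with
  | nil => rfl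
  | cons x t ih => cases x <;> simp [bFun, aFun_aFun, ih]

/-- The automorphism `a` of the binary rooted tree. -/
def aPerm : Equiv.Perm (List Bool) := ⟨aFun, aFun, aFun_aFun, aFun_aFun⟩

/-- The automorphism `b` of the binary rooted tree. -/
def bPerm : Equiv.Perm (List Bool) := ⟨bFun, bFun, bFun_bFun, bFun_bFun⟩

/-- Two involutions `x, y` of a group determine a homomorphism from the infinite dihedral group. -/
def infiniteDihedralLift {G : Type*} [Group G] (x y : G) (hx : x ^ 2 = 1) (hy : y ^ 2 = 1) :
    DihedralGroup 0 →* G :=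
  have conj (k : ℤ) : (x * y) ^ k * x = x * (x * y) ^ (-k) := by
    have hx' : x⁻¹ = x := inv_eq_of_mul_eq_one_right (by rw [← sq, hx])
    have hy' : y⁻¹ = y := inv_eq_of_mul_eq_one_right (by rw [← sq, hy])
    have h : SemiconjBy x (x * y)⁻¹ (x * y) := by
      simp only [SemiconjBy, mul_inv_rev, hx', hy', mul_assoc]
    rw [zpow_neg, ← inv_zpow]
    exact (h.zpow_right k).eq.symm
  MonoidHom.mk'
    (fun
      | .r i => (x * y) ^ (show ℤ from i)
      | .sr i => x * (x * y) ^ (show ℤ from i)) <| by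
    have hxx : x * x = 1 := by rw [← sq, hx]
    rintro (i | i) (j | j)
    · exact zpow_add (x * y) _ _
    · change x * (x * y) ^ ((show ℤ from j) - (show ℤ from i)) = _
      rw [← mul_assoc, conj, mul_assoc, ← zpow_add, neg_add_eq_sub]
    · change x * (x * y) ^ ((show ℤ from i) + (show ℤ from j)) = _
      rw [zpow_add, mul_assoc]
    · change (x * y) ^ ((show ℤ from j) - (show ℤ from i)) = _
      rw [mul_assoc, ← mul_assoc _ x, conj, mul_assoc, ← zpow_add, ← mul_assoc, hxx, one_mul,
        neg_add_eq_sub]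

section InfiniteDihedral

variable {G : Type*} [Group G] {x y : G} (hx : x ^ 2 = 1) (hy : y ^ 2 = 1)

lemma infiniteDihedralLift_sr (i : ℤ) :
    infiniteDihedralLift x y hx hy (.sr i) = x * (x * y) ^ i := rfl

lemma infiniteDihedralLift_injective (h : ¬ IsOfFinOrder (x * y)) :
    Function.Injective (infiniteDihedralLift x y hx hy) := by
  have inj : Function.Injective fun k : ℤ => (x * y) ^ k := injective_zpow_iff_not_isOfFinOrder.2 h
  rw [injective_iff_map_eq_one]
  rintro (i | i) hi
  · replace hi : (x * y) ^ (show ℤ from i) = 1 := hi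
    exact congrArg DihedralGroup.r (inj (hi.trans (zpow_zero _).symm))
  · replace hi : x * (x * y) ^ (show ℤ from i) = 1 := hi
    have hxi : (x * y) ^ (show ℤ from i) = x⁻¹ := (inv_eq_of_mul_eq_one_right hi).symm
    have h0 : (show ℤ from i) * 2 = 0 := inj <| by
      change (x * y) ^ ((show ℤ from i) * 2) = (x * y) ^ (0 : ℤ)
      rw [zpow_mul, hxi, zpow_zero, inv_zpow, zpow_ofNat, hx, inv_one]
    have hi0 : (show ℤ from i) = 0 := by omega
    rw [hi0, zpow_zero, eq_comm, inv_eq_one] at hxi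
    rw [hxi, one_mul] at h
    exact absurd (isOfFinOrder_iff_pow_eq_one.2 ⟨2, two_pos, hy⟩) h

lemma infiniteDihedralLift_range :
    (infiniteDihedralLift x y hx hy).range = Subgroup.closure {x, y} := by
  have hxm : x ∈ Subgroup.closure {x, y} := Subgroup.subset_closure (by simp)
  have hym : y ∈ Subgroup.closure {x, y} := Subgroup.subset_closure (by simp)
  apply le_antisymm
  · rintro _ ⟨i | i, rfl⟩
    · exact zpow_mem (mul_mem hxm hym) _
    · exact mul_mem hxm (zpow_mem (mul_mem hxm hym) _)
  · rw [Subgroup.closure_le]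
    rintro _ (rfl | rfl)
    · exact ⟨.sr (0 : ℤ), by rw [infiniteDihedralLift_sr, zpow_zero, mul_one]⟩
    · exact ⟨.sr (1 : ℤ), by
        rw [infiniteDihedralLift_sr, zpow_one, ← mul_assoc, ← sq, hx, one_mul]⟩

end InfiniteDihedral

lemma aPerm_sq : aPerm ^ 2 = 1 := by
  rw [sq]
  exact Equiv.ext aFun_aFun

lemma bPerm_sq : bPerm ^ 2 = 1 := by
  rw [sq]
  exact Equiv.ext bFun_bFun

lemma aPerm_mul_bPerm_sq_false_cons (w : List Bool) :
    ((aPerm * bPerm) ^ 2) (false :: w) = false :: (aPerm * bPerm) w := by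
  rw [sq]
  rfl

lemma aPerm_mul_bPerm_pow_even_false_cons (m : ℕ) (w : List Bool) :
    ((aPerm * bPerm) ^ (2 * m)) (false :: w) = false :: ((aPerm * bPerm) ^ m) w := by
  induction m generalizing w with
  | zero => rfl
  | succ m ih =>
    rw [mul_add, mul_one, pow_add, Equiv.Perm.mul_apply, aPerm_mul_bPerm_sq_false_cons, ih,
      pow_succ]
    rfl

lemma aPerm_mul_bPerm_pow_eq_one {n : ℕ} (h : (aPerm * bPerm) ^ n = 1) : n = 0 := by
  induction n using Nat.strong_induction_on with
  | _ n ih =>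
    obtain ⟨m, rfl | rfl⟩ := n.even_or_odd'
    · have hm : (aPerm * bPerm) ^ m = 1 := Equiv.ext fun w => by
        have := aPerm_mul_bPerm_pow_even_false_cons m w
        rw [h] at this
        exact (List.cons.inj this).2.symm
      by_contra hne
      exact hne (by rw [ih m (by omega) hm])
    · have hflip : ((aPerm * bPerm) ^ (2 * m + 1)) [false] =
          (aPerm * bPerm) (false :: ((aPerm * bPerm) ^ m) []) := by
        rw [pow_succ', Equiv.Perm.mul_apply, aPerm_mul_bPerm_pow_even_false_cons]
      rw [h] at hflip
      exact absurd (List.cons.inj hflip).1 Bool.false_ne_true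

lemma not_isOfFinOrder_aPerm_mul_bPerm : ¬ IsOfFinOrder (aPerm * bPerm) := by
  rw [isOfFinOrder_iff_pow_eq_one]
  rintro ⟨n, hn, h⟩
  exact hn.ne' (aPerm_mul_bPerm_pow_eq_one h)

/-- The automorphisms `a, b` of `{0,1}^*` given by `a(0w) = 1w`, `a(1w) = 0w`,
`b(0w) = 0·b(w)`, `b(1w) = 1·a(w)` satisfy `a² = 1`, `b² = 1`, the element `ab`
has infinite order, and `⟨a, b⟩` is isomorphic to the infinite dihedral group
(`DihedralGroup 0`).  This group is `IMG(z² − 2)`. -/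
theorem statement11 :
    aPerm ^ 2 = 1 ∧ bPerm ^ 2 = 1 ∧ ¬ IsOfFinOrder (aPerm * bPerm) ∧
    Nonempty ((Subgroup.closure {aPerm, bPerm} :
      Subgroup (Equiv.Perm (List Bool))) ≃* DihedralGroup 0) := by
  refine ⟨aPerm_sq, bPerm_sq, not_isOfFinOrder_aPerm_mul_bPerm, ⟨?_⟩⟩
  rw [← infiniteDihedralLift_range aPerm_sq bPerm_sq]
  exact (MonoidHom.ofInjective (infiniteDihedralLift_injective aPerm_sq bPerm_sq
    not_isOfFinOrder_aPerm_mul_bPerm)).symm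
end

section
/- Let A be an n × n matrix with integer entries whose determinant has absolute value d > 1. Then the subgroup ⋂_{k≥1} A^k(ℤⁿ) of ℤⁿ is trivial if and only if no eigenvalue of the inverse matrix A⁻¹ (viewed as a complex matrix) is an algebraic integer. (Consequently, the iterated monodromy action of ℤⁿ = π₁(𝕋ⁿ) for the self-covering of the torus induced by A is faithful exactly under this condition.) -/
open Polynomial in
/-- For a sequence in a Noetherian `ℤ`-module, some term is an integral combination of the
preceding ones; this is expressed through the linear map `ℤ[X] → M` sending `X ^ i` to `w i`. -/
theorem exists_monic_lsum_eq_zero {M : Type*} [AddCommGroup M] [IsNoetherian ℤ M] (w : ℕ → M) :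
    ∃ p : ℤ[X], p.Monic ∧ Polynomial.lsum (fun i => LinearMap.toSpanSingleton ℤ M (w i)) p = 0 := by
  set G := Polynomial.lsum (fun i => LinearMap.toSpanSingleton ℤ M (w i))
  obtain ⟨m, hm⟩ := monotone_stabilizes_iff_noetherian.mpr ‹IsNoetherian ℤ M›
    ⟨fun m => (degreeLT ℤ m).map G, fun _ _ hab => Submodule.map_mono (degreeLT_mono hab)⟩
  have hX : G (X ^ m) ∈ (degreeLT ℤ m).map G := by
    have h : G (X ^ m) ∈ (degreeLT ℤ (m + 1)).map G :=
      Submodule.mem_map_of_mem (mem_degreeLT.2 (by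
        rw [degree_X_pow]
        exact_mod_cast Nat.lt_succ_self m))
    exact (hm (m + 1) (Nat.le_succ m)).ge h
  obtain ⟨r, hr, hrG⟩ := hX
  exact ⟨X ^ m - r, monic_X_pow_sub (mem_degreeLT.1 hr), by
    rw [map_sub, hrG, sub_self]⟩

open Polynomial in
/-- If `p(B)` kills a nonzero vector, then some root of `p` is an eigenvalue of `B`. -/
theorem Matrix.exists_eigenvector_of_aeval_mulVec_eq_zero {n : Type*} [Fintype n] [DecidableEq n]
    {B : Matrix n n ℂ} {p : ℂ[X]} {x : n → ℂ} (hx : x ≠ 0) (h : (aeval B p).mulVec x = 0) :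
    ∃ μ : ℂ, (∃ v : n → ℂ, v ≠ 0 ∧ B.mulVec v = μ • v) ∧ p.eval μ = 0 := by
  have hn : Nonempty n := by
    by_contra hn
    rw [not_nonempty_iff] at hn
    exact hx (Subsingleton.elim _ _)
  have hmem : (0 : ℂ) ∈ spectrum ℂ (aeval B p) := by
    rw [spectrum.zero_mem_iff, Matrix.isUnit_iff_isUnit_det, isUnit_iff_ne_zero, not_not]
    exact Matrix.exists_mulVec_eq_zero_iff.1 ⟨x, hx, h⟩
  rw [spectrum.map_polynomial_aeval_of_nonempty B p
    (spectrum.nonempty_of_isAlgClosed_of_finiteDimensional ℂ B)] at hmem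
  obtain ⟨μ, hμ, hpμ⟩ := hmem
  rw [spectrum.mem_iff, Matrix.isUnit_iff_isUnit_det, isUnit_iff_ne_zero, not_not] at hμ
  obtain ⟨v, hv, hBv⟩ := Matrix.exists_mulVec_eq_zero_iff.2 hμ
  refine ⟨μ, ⟨v, hv, ?_⟩, hpμ⟩
  rw [Matrix.sub_mulVec, sub_eq_zero, Algebra.algebraMap_eq_smul_one, Matrix.smul_mulVec,
    Matrix.one_mulVec] at hBv
  exact hBv.symm

open Polynomial in
theorem Matrix.aeval_mulVec_of_eigenvector {n : Type*} [Fintype n] [DecidableEq n]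
    {B : Matrix n n ℂ} {v : n → ℂ} {μ : ℂ} (h : B.mulVec v = μ • v) (q : ℤ[X]) :
    (aeval B q).mulVec v = aeval μ q • v := by
  have hpow (k : ℕ) : (B ^ k).mulVec v = μ ^ k • v := by
    induction k with
    | zero => simp
    | succ k ih => rw [pow_succ, ← Matrix.mulVec_mulVec, h, Matrix.mulVec_smul, ih, smul_smul,
        pow_succ, mul_comm]
  induction q using Polynomial.induction_on' with
  | add p q hp hq => rw [map_add, map_add, Matrix.add_mulVec, hp, hq, add_smul]
  | monomial k a =>
    rw [aeval_monomial, aeval_monomial, ← Matrix.mulVec_mulVec, hpow,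
      Algebra.algebraMap_eq_smul_one, Algebra.algebraMap_eq_smul_one, Matrix.smul_mulVec,
      Matrix.one_mulVec, smul_mul_assoc, one_mul, smul_assoc]

open Polynomial in
/-- If `q(A)` kills `v` and `q` has constant coefficient `1`, then `v` lies in the image of every
power of `A`. -/
theorem Matrix.exists_pow_mulVec_eq_of_aeval_mulVec_eq_zero {n R : Type*} [Fintype n]
    [DecidableEq n] [CommRing R] {A : Matrix n n R} {q : R[X]} (hq : q.coeff 0 = 1) {v : n → R}
    (h : (aeval A q).mulVec v = 0) (k : ℕ) : ∃ u, (A ^ k).mulVec u = v := by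
  set S := aeval A (-q.divX) with hS
  have hcomm : Commute A S := by
    have := (Commute.all (X : R[X]) (-q.divX)).map (aeval A)
    rwa [aeval_X] at this
  have hv : (A * S).mulVec v = v := by
    rw [← X_mul_divX_add q, hq] at h
    simp only [map_add, map_mul, aeval_X, map_one, Matrix.add_mulVec, Matrix.one_mulVec] at h
    rw [hS, map_neg, mul_neg, Matrix.neg_mulVec]
    exact neg_eq_of_add_eq_zero_right h
  refine ⟨(S ^ k).mulVec v, ?_⟩
  rw [Matrix.mulVec_mulVec, ← hcomm.mul_pow]
  induction k with
  | zero => simp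
  | succ k ih => rw [pow_succ, ← Matrix.mulVec_mulVec, hv, ih]

open Polynomial in
/-- Let `A` be an `n × n` integer matrix with `|det A| = d > 1`.  The subgroup
`⋂_{k ≥ 1} A^k(ℤⁿ)` of `ℤⁿ` is trivial if and only if no eigenvalue of `A⁻¹`
(viewed as a complex matrix) is an algebraic integer.  (Equivalently, the
iterated monodromy action of `ℤⁿ = π₁(𝕋ⁿ)` for the self-covering of the torus
induced by `A` is faithful exactly under this condition.) -/
theorem statement16 {n : ℕ} (A : Matrix (Fin n) (Fin n) ℤ) (d : ℕ)
    (hdet : A.det.natAbs = d) (hd : 1 < d) :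
    ((⋂ k : ℕ, Set.range fun v : Fin n → ℤ => (A ^ (k + 1)).mulVec v) = {0}) ↔
      ¬ ∃ μ : ℂ,
        (∃ v : Fin n → ℂ, v ≠ 0 ∧
          ((A.map (Int.cast : ℤ → ℂ))⁻¹).mulVec v = μ • v) ∧
        IsIntegral ℤ μ := by
  set C : Matrix (Fin n) (Fin n) ℂ := A.map (Int.cast : ℤ → ℂ) with hC
  have hCmap : C = (Int.castRingHom ℂ).mapMatrix A := rfl
  have hCdet : IsUnit C.det := by
    rw [hCmap, ← RingHom.map_det, isUnit_iff_ne_zero, eq_intCast, Int.cast_ne_zero]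
    rintro h
    simp [h] at hdet
    omega
  have hCC : C⁻¹ * C = 1 := Matrix.nonsing_inv_mul C hCdet
  constructor
  · rintro hH ⟨μ, ⟨v, hv, hμv⟩, p, hp, hpμ⟩
    have hμ : μ ≠ 0 := by
      rintro rfl
      apply hv
      rw [← Matrix.one_mulVec v, ← Matrix.mul_nonsing_inv C hCdet, ← Matrix.mulVec_mulVec, hμv,
        zero_smul, Matrix.mulVec_zero]
    have hCv : C.mulVec v = μ⁻¹ • v := by
      rw [eq_inv_smul_iff₀ hμ, ← Matrix.mulVec_smul, ← hμv, Matrix.mulVec_mulVec,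
        Matrix.mul_nonsing_inv C hCdet, Matrix.one_mulVec]
    have hroot : aeval μ⁻¹ p.reverse = 0 := by
      have : Invertible μ := invertibleOfNonzero hμ
      rw [← invOf_eq_inv μ]
      exact (eval₂_reverse_eq_zero_iff _ _ _).2 hpμ
    have hCq : (aeval C p.reverse).mulVec v = 0 := by
      rw [Matrix.aeval_mulVec_of_eigenvector hCv, hroot, zero_smul]
    let φ : Matrix (Fin n) (Fin n) ℤ →ₐ[ℤ] Matrix (Fin n) (Fin n) ℂ :=
      (Int.castRingHom ℂ).mapMatrix.toIntAlgHom
    have hdetq : (aeval A p.reverse).det = 0 := by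
      have h0 := Matrix.exists_mulVec_eq_zero_iff.1 ⟨v, hv, hCq⟩
      have hmap : aeval C p.reverse = (Int.castRingHom ℂ).mapMatrix (aeval A p.reverse) :=
        aeval_algHom_apply φ A p.reverse
      rw [hmap, ← RingHom.map_det, eq_intCast, Int.cast_eq_zero] at h0
      exact h0
    obtain ⟨u, hu, hqu⟩ := Matrix.exists_mulVec_eq_zero_iff.2 hdetq
    have hmem : u ∈ (⋂ k : ℕ, Set.range fun v : Fin n → ℤ => (A ^ (k + 1)).mulVec v) :=
      Set.mem_iInter.2 fun k => Matrix.exists_pow_mulVec_eq_of_aeval_mulVec_eq_zero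
        (by rw [coeff_zero_reverse, hp.leadingCoeff]) hqu (k + 1)
    rw [hH] at hmem
    exact hu hmem
  · intro hno
    refine Set.eq_singleton_iff_unique_mem.2
      ⟨Set.mem_iInter.2 fun k => ⟨0, Matrix.mulVec_zero _⟩, fun h hh => ?_⟩
    by_contra hne
    have hw (k : ℕ) : ∃ u, (A ^ k).mulVec u = h := by
      obtain ⟨u, hu⟩ := Set.mem_iInter.1 hh k
      exact ⟨A.mulVec u, by rw [Matrix.mulVec_mulVec, ← pow_succ]; exact hu⟩
    choose w hw using hw
    obtain ⟨p, hp, hpw⟩ := exists_monic_lsum_eq_zero w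
    let ι : (Fin n → ℤ) →ₗ[ℤ] (Fin n → ℂ) := (Int.castAddHom ℂ).toIntLinearMap.compLeft (Fin n)
    have hι (M : Matrix (Fin n) (Fin n) ℤ) (x : Fin n → ℤ) :
        ((Int.castRingHom ℂ).mapMatrix M).mulVec (ι x) = ι (M.mulVec x) := by
      ext i
      exact ((Int.castRingHom ℂ).map_mulVec M x i).symm
    have hιne : ι h ≠ 0 := fun h0 => hne <| funext fun i => by
      have := congrFun h0 i
      exact Int.cast_eq_zero.1 this
    have hpow (k : ℕ) : (C⁻¹ ^ k).mulVec (ι h) = ι (w k) := by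
      rw [← hw k, ← hι, map_pow, ← hCmap, Matrix.mulVec_mulVec,
        ← (show Commute C⁻¹ C from hCC.trans (Matrix.mul_nonsing_inv C hCdet).symm).mul_pow,
        hCC, one_pow, Matrix.one_mulVec]
    have heval (q : ℤ[X]) : (aeval C⁻¹ q).mulVec (ι h) =
        ι (Polynomial.lsum (fun i => LinearMap.toSpanSingleton ℤ _ (w i)) q) := by
      induction q using Polynomial.induction_on' with
      | add p q hp hq => rw [map_add, map_add, map_add, Matrix.add_mulVec, hp, hq]
      | monomial k a =>
        rw [aeval_monomial, ← Matrix.mulVec_mulVec, hpow, Algebra.algebraMap_eq_smul_one,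
          Matrix.smul_mulVec, Matrix.one_mulVec, ← map_smul]
        simp [Polynomial.lsum_apply, Polynomial.sum_monomial_index]
    have hzero : (aeval C⁻¹ (p.map (algebraMap ℤ ℂ))).mulVec (ι h) = 0 := by
      rw [aeval_map_algebraMap, heval, hpw, map_zero]
    obtain ⟨μ, hμ, hpμ⟩ := Matrix.exists_eigenvector_of_aeval_mulVec_eq_zero hιne hzero
    exact hno ⟨μ, hμ, p, hp, by rwa [eval_map] at hpμ⟩
end
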